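/- Lemma 9.1, part 2. Let ℓ be a fixed nonnegative integer, and suppose the sequence β_{ℓ,n} defined by Λ_1(n) = (log n + ℓ log log n + β_{ℓ,n})/n satisfies β_{ℓ,n} = o(log n), and that in addition K_{r,n}/K_{1,n} = o(log n). Then α_n p_{rr}(n) = o((log n)²/n), i.e., n·α_n p_{rr}(n)/(log n)² → 0; and α_n p_{1r}(n) = o(log n)·α_n p_{11}(n), i.e., p_{1r}(n)/(p_{11}(n)·log n) → 0. -/

import Mathlib

open Finset Filter Real
open scoped Classical

/-- A configuration: class assignment, key rings, channel on/off indicators. -/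
abbrev Cfg (n r P : ℕ) := (Fin n → Fin r) × (Fin n → Finset (Fin P)) × (Fin n → Fin n → Bool)

/-- Adjacency in the intersection graph `H(n)`: distinct vertices sharing a key
with the channel between them on. -/
def adj {n r P : ℕ} (ω : Cfg n r P) (x y : Fin n) : Prop :=
  x ≠ y ∧ ((ω.2.1 x) ∩ (ω.2.1 y)).Nonempty ∧ ω.2.2 (min x y) (max x y) = true

/-- Degree of a vertex in `H(n)`. -/
noncomputable def deg {n r P : ℕ} (ω : Cfg n r P) (x : Fin n) : ℕ :=
  (Finset.univ.filter (fun y => adj ω x y)).card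

/-- Probability weight of a configuration: classes are i.i.d. with law `μ`,
key rings uniform over `K`-subsets given the class, channels i.i.d. Bernoulli(`α`). -/
noncomputable def wt {n r P : ℕ} (μ : Fin r → ℝ) (K : Fin r → ℕ) (α : ℝ)
    (ω : Cfg n r P) : ℝ :=
  (∏ x : Fin n, μ (ω.1 x) *
      (if (ω.2.1 x).card = K (ω.1 x) then ((P.choose (K (ω.1 x)) : ℝ))⁻¹ else 0)) *
  ∏ p ∈ Finset.univ.filter (fun p : Fin n × Fin n => p.1 < p.2),
      (if ω.2.2 p.1 p.2 then α else 1 - α)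

/-- Probability of an event under the random graph model. -/
noncomputable def Pr {n r P : ℕ} (μ : Fin r → ℝ) (K : Fin r → ℕ) (α : ℝ)
    (E : Cfg n r P → Prop) : ℝ :=
  ∑ ω : Cfg n r P, if E ω then wt μ K α ω else 0

/-- Key-graph edge probability `p_{ij}` between a class-`i` and a class-`j` node. -/
noncomputable def pEdge {r : ℕ} (Pn : ℕ) (Kn : Fin r → ℕ) (i j : Fin r) : ℝ :=
  1 - ((Pn - Kn i).choose (Kn j) : ℝ) / ((Pn.choose (Kn j) : ℝ))

/-- Mean key-graph edge probability `λ_i` for a class-`i` node. -/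
noncomputable def lam {r : ℕ} (μ : Fin r → ℝ) (Pn : ℕ) (Kn : Fin r → ℕ) (i : Fin r) : ℝ :=
  ∑ j, μ j * pEdge Pn Kn i j

/-- Averages of an antitone sequence over initial segments decrease. -/
theorem mul_sum_range_le_of_antitone {d : ℕ → ℝ} (hd : Antitone d) {k m : ℕ} (hkm : k ≤ m) :
    (k : ℝ) * ∑ i ∈ range m, d i ≤ m * ∑ i ∈ range k, d i := by
  induction m, hkm using Nat.le_induction with
  | base => exact le_rfl
  | succ m hm ih =>
    have h : (k : ℝ) * d m ≤ ∑ i ∈ range k, d i := by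
      have := Finset.card_nsmul_le_sum (range k) d (d m)
        (fun i hi => hd ((Finset.mem_range.1 hi).le.trans hm))
      simpa using this
    rw [Finset.sum_range_succ]
    push_cast
    linarith

theorem choose_sub_choose_eq_sum (P b m : ℕ) (hm : m ≤ P) :
    (P.choose (b + 1) : ℝ) - ((P - m).choose (b + 1) : ℝ) =
      ∑ i ∈ range m, ((P - 1 - i).choose b : ℝ) := by
  induction m with
  | zero => simp
  | succ m ih =>
    rw [Finset.sum_range_succ, ← ih (by omega)]
    obtain ⟨t, rfl⟩ : ∃ t, P = t + m + 1 := ⟨P - m - 1, by omega⟩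
    have h1 : t + m + 1 - m = t + 1 := by omega
    have h2 : t + m + 1 - (m + 1) = t := by omega
    have h3 : t + m + 1 - 1 - m = t := by omega
    rw [h1, h2, h3, Nat.choose_succ_succ' t b]
    push_cast
    ring

theorem pEdge_nonneg {r : ℕ} (P : ℕ) (K : Fin r → ℕ) (i j : Fin r) : 0 ≤ pEdge P K i j := by
  unfold pEdge
  have h : ((P - K i).choose (K j) : ℝ) ≤ P.choose (K j) := by
    exact_mod_cast Nat.choose_le_choose _ (Nat.sub_le _ _)
  linarith [div_le_one_of_le₀ h (Nat.cast_nonneg _)]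

theorem pEdge_comm {r : ℕ} {P : ℕ} {K : Fin r → ℕ} {i j : Fin r} (h : K i + K j ≤ P) :
    pEdge P K i j = pEdge P K j i := by
  unfold pEdge
  have hi : (P.choose (K i) : ℝ) ≠ 0 := by
    exact_mod_cast (Nat.choose_pos (by omega : K i ≤ P)).ne'
  have hj : (P.choose (K j) : ℝ) ≠ 0 := by
    exact_mod_cast (Nat.choose_pos (by omega : K j ≤ P)).ne'
  have h1 := Nat.choose_mul (n := P) (Nat.le_add_right (K i) (K j))
  have h2 := Nat.choose_mul (n := P) (Nat.le_add_left (K j) (K i))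
  rw [Nat.add_sub_cancel_left] at h1
  rw [Nat.add_sub_cancel] at h2
  have h3 : (K i + K j).choose (K i) = (K i + K j).choose (K j) :=
    Nat.choose_symm_of_eq_add rfl
  rw [h3, h2] at h1
  congr 1
  rw [div_eq_div_iff hj hi]
  have h4 : (P.choose (K j) : ℝ) * (P - K j).choose (K i) =
      P.choose (K i) * (P - K i).choose (K j) := by exact_mod_cast h1
  linarith

/-- `p_{ij}` grows at most linearly in the key ring size of the first class. -/
theorem mul_pEdge_le {r : ℕ} {P : ℕ} {K : Fin r → ℕ} {i j : Fin r} (l : Fin r)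
    (hl : 0 < K l) (hij : K i ≤ K j) (hj : K j ≤ P) :
    (K i : ℝ) * pEdge P K j l ≤ K j * pEdge P K i l := by
  rcases lt_or_ge P (K l) with hP | hP
  · simp [pEdge, Nat.choose_eq_zero_of_lt hP, hij]
  · have hc : (0 : ℝ) < P.choose (K l) := by exact_mod_cast Nat.choose_pos hP
    obtain ⟨b, hb⟩ : ∃ b, K l = b + 1 := ⟨K l - 1, by omega⟩
    unfold pEdge
    rw [hb] at hc ⊢
    rw [one_sub_div hc.ne', one_sub_div hc.ne', choose_sub_choose_eq_sum P b _ hj,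
      choose_sub_choose_eq_sum P b _ (hij.trans hj), ← mul_div_assoc, ← mul_div_assoc]
    refine div_le_div_of_nonneg_right (mul_sum_range_le_of_antitone ?_ hij) hc.le
    intro s t hst
    dsimp only
    exact_mod_cast Nat.choose_le_choose b (Nat.sub_le_sub_left hst (P - 1))

theorem mul_pEdge_le_lam {r : ℕ} {μ : Fin r → ℝ} (hμ : ∀ i, 0 < μ i) (P : ℕ) (K : Fin r → ℕ)
    (i j : Fin r) : μ j * pEdge P K i j ≤ lam μ P K i :=
  Finset.single_le_sum (f := fun j => μ j * pEdge P K i j)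
    (fun k _ => mul_nonneg (hμ k).le (pEdge_nonneg P K i k)) (Finset.mem_univ j)

theorem tendsto_log_log_div_log :
    Tendsto (fun n : ℕ => Real.log (Real.log n) / Real.log n) atTop (nhds 0) :=
  (Real.isLittleO_log_id_atTop.tendsto_div_nhds_zero).comp
    (Real.tendsto_log_atTop.comp tendsto_natCast_atTop_atTop)

/-- Lemma 9.1, part 2: `αₙ pᵣᵣ(n) = o((log n)²/n)` and
`αₙ p₁ᵣ(n) = o(log n) · αₙ p₁₁(n)`. -/
theorem alpha_prr_and_p1r_little_o
    (r : ℕ) (hr : 0 < r) (μ : Fin r → ℝ)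
    (hμpos : ∀ i, 0 < μ i) (hμsum : ∑ i, μ i = 1)
    (Kf : ℕ → Fin r → ℕ) (Pf : ℕ → ℕ) (αf : ℕ → ℝ)
    (hKmono : ∀ n, 2 ≤ n → ∀ i j : Fin r, i ≤ j → Kf n i ≤ Kf n j)
    (hK2 : ∀ n, 2 ≤ n → 2 ≤ Kf n ⟨0, hr⟩)
    (hKP : ∀ n, 2 ≤ n → 2 * Kf n ⟨r - 1, Nat.sub_lt hr Nat.one_pos⟩ ≤ Pf n)
    (hα : ∀ n, 2 ≤ n → 0 < αf n ∧ αf n < 1)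
    (ℓ : ℕ) (β : ℕ → ℝ)
    (hβdef : ∀ n, 2 ≤ n → αf n * lam μ (Pf n) (Kf n) (⟨0, hr⟩ : Fin r) =
      (Real.log n + (ℓ : ℝ) * Real.log (Real.log n) + β n) / n)
    (hβo : Tendsto (fun n : ℕ => β n / Real.log n) atTop (nhds 0))
    (hKrK1 : Tendsto (fun n : ℕ =>
      ((Kf n (⟨r - 1, Nat.sub_lt hr Nat.one_pos⟩ : Fin r) : ℝ) / (Kf n (⟨0, hr⟩ : Fin r) : ℝ)) / Real.log n) atTop (nhds 0)) :
    Tendsto (fun n : ℕ => (n : ℝ) * (αf n * pEdge (Pf n) (Kf n) (⟨r - 1, Nat.sub_lt hr Nat.one_pos⟩ : Fin r) (⟨r - 1, Nat.sub_lt hr Nat.one_pos⟩ : Fin r)) / (Real.log n) ^ 2) atTop (nhds 0) ∧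
    Tendsto (fun n : ℕ => pEdge (Pf n) (Kf n) (⟨0, hr⟩ : Fin r) (⟨r - 1, Nat.sub_lt hr Nat.one_pos⟩ : Fin r) / (pEdge (Pf n) (Kf n) (⟨0, hr⟩ : Fin r) (⟨0, hr⟩ : Fin r) * Real.log n)) atTop (nhds 0) := by
  set o : Fin r := ⟨0, hr⟩ with ho
  set e : Fin r := ⟨r - 1, Nat.sub_lt hr Nat.one_pos⟩ with he
  have hoe : o ≤ e := Fin.mk_le_mk.2 (Nat.zero_le _)
  have hlog : ∀ n : ℕ, 2 ≤ n → 0 < Real.log n := fun n hn =>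
    Real.log_pos (by exact_mod_cast hn)
  constructor
  · have hL : Tendsto (fun n : ℕ => 1 + (ℓ : ℝ) * (Real.log (Real.log n) / Real.log n) +
        β n / Real.log n) atTop (nhds (1 + (ℓ : ℝ) * 0 + 0)) :=
      ((tendsto_log_log_div_log.const_mul _).const_add 1).add hβo
    have hbound := (hL.const_mul (μ e)⁻¹).mul hKrK1
    rw [mul_zero] at hbound
    refine squeeze_zero' ?_ ?_ hbound
    · filter_upwards [eventually_ge_atTop 2] with n hn
      have := (hα n hn).1
      have := pEdge_nonneg (Pf n) (Kf n) e e
      positivity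
    · filter_upwards [eventually_ge_atTop 2] with n hn
      have hlogn := hlog n hn
      have hαn := (hα n hn).1
      have hn0 : (0 : ℝ) < n := by exact_mod_cast (by omega : 0 < n)
      have hKoe := hKmono n hn o e hoe
      have hKo := hK2 n hn
      have hKe := hKP n hn
      have hKo0 : (0 : ℝ) < Kf n o := by exact_mod_cast (by omega : 0 < Kf n o)
      have hμe := hμpos e
      have h1 : pEdge (Pf n) (Kf n) e e ≤
          (Kf n e : ℝ) / Kf n o * ((μ e)⁻¹ * lam μ (Pf n) (Kf n) o) := by
        have h2 := mul_pEdge_le (P := Pf n) (K := Kf n) (i := o) (j := e) e (by omega) hKoe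
          (by omega)
        have h3 : pEdge (Pf n) (Kf n) o e ≤ (μ e)⁻¹ * lam μ (Pf n) (Kf n) o := by
          rw [inv_mul_eq_div, le_div_iff₀' hμe]
          exact mul_pEdge_le_lam hμpos _ _ _ _
        calc pEdge (Pf n) (Kf n) e e ≤ (Kf n e : ℝ) / Kf n o * pEdge (Pf n) (Kf n) o e := by
              rw [div_mul_eq_mul_div, le_div_iff₀' hKo0]
              exact h2
          _ ≤ _ := mul_le_mul_of_nonneg_left h3 (by positivity)
      have h4 : (n : ℝ) * (αf n * lam μ (Pf n) (Kf n) o) =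
          Real.log n + (ℓ : ℝ) * Real.log (Real.log n) + β n := by
        rw [hβdef n hn]
        field_simp
      calc (n : ℝ) * (αf n * pEdge (Pf n) (Kf n) e e) / Real.log n ^ 2
          ≤ (n : ℝ) * (αf n * ((Kf n e : ℝ) / Kf n o * ((μ e)⁻¹ * lam μ (Pf n) (Kf n) o))) /
              Real.log n ^ 2 := by gcongr
        _ = (μ e)⁻¹ * ((n : ℝ) * (αf n * lam μ (Pf n) (Kf n) o) / Real.log n) *
              ((Kf n e : ℝ) / Kf n o / Real.log n) := by
            field_simp
        _ = _ := by
            rw [h4]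
            field_simp
  · refine squeeze_zero' ?_ ?_ hKrK1
    · filter_upwards [eventually_ge_atTop 2] with n hn
      have := hlog n hn
      have := pEdge_nonneg (Pf n) (Kf n) o e
      have := pEdge_nonneg (Pf n) (Kf n) o o
      positivity
    · filter_upwards [eventually_ge_atTop 2] with n hn
      have hlogn := hlog n hn
      have hKoe := hKmono n hn o e hoe
      have hKo := hK2 n hn
      have hKe := hKP n hn
      have hKo0 : (0 : ℝ) < Kf n o := by exact_mod_cast (by omega : 0 < Kf n o)
      have h1 := mul_pEdge_le (P := Pf n) (K := Kf n) (i := o) (j := e) o (by omega) hKoe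
        (by omega)
      have hp := pEdge_nonneg (Pf n) (Kf n) o o
      rw [← div_div]
      refine div_le_div_of_nonneg_right (div_le_of_le_mul₀ hp (by positivity) ?_) hlogn.le
      rw [pEdge_comm (by omega), div_mul_eq_mul_div, le_div_iff₀' hKo0]
      exact h1
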